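/- Let a, m be real numbers, n a natural number, and let A = {A_1, ..., A_q} and B = {B_1, ..., B_q} be families of subsets of [n] = {1,...,n} such that A_i ≠ ∅ for all i, and A_j ⊆ B_k if and only if j = k. If ak + m ≠ 0 for all integers k with min_{A ∈ A} |A| ≤ k ≤ n, then ∑_{i=1}^q (a·|A_i| + m) · g_{a,m}(n − |B_i| + |A_i|, |A_i|) + ∑_{X ∈ U_n(A) \ D_n(B)} (a·|Z_A(X)| + m) · g_{a,m}(n, |X|) = 1. -/

import Mathlib

open Finset

def upSet (n : ℕ) (F : Finset (Finset (Fin n))) : Finset (Finset (Fin n)) :=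
  univ.filter (fun X => ∃ A ∈ F, A ⊆ X)

def downSet (n : ℕ) (F : Finset (Finset (Fin n))) : Finset (Finset (Fin n)) :=
  univ.filter (fun X => ∃ A ∈ F, X ⊆ A)

def zSet (n : ℕ) (F : Finset (Finset (Fin n))) (X : Finset (Fin n)) : Finset (Fin n) :=
  if X ∈ upSet n F then (F.filter (fun A => A ⊆ X)).inf id else ∅

def joinFam (n : ℕ) (F G : Finset (Finset (Fin n))) : Finset (Finset (Fin n)) :=
  (F ×ˢ G).image (fun p => p.1 ∪ p.2)

noncomputable def g (a m : ℝ) (n l : ℕ) : ℝ :=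
  (Nat.factorial (n - l) : ℝ) * a ^ (n - l) / ∏ k ∈ Finset.Icc l n, (a * k + m)

/-- The telescoping relation for `g` in its second argument. -/
theorem g_mul_eq (a m : ℝ) {n l : ℕ} (hl : l < n) (h : a * l + m ≠ 0) :
    (a * l + m) * g a m n l = a * ((n - l : ℕ) : ℝ) * g a m n (l + 1) := by
  obtain ⟨d, rfl⟩ := Nat.exists_eq_add_of_lt hl
  have h1 : l + d + 1 - l = d + 1 := by omega
  have h2 : l + d + 1 - (l + 1) = d := by omega
  have h3 : ∏ k ∈ Icc l (l + d + 1), (a * (k : ℝ) + m)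
      = (a * l + m) * ∏ k ∈ Icc (l + 1) (l + d + 1), (a * (k : ℝ) + m) := by
    rw [← Finset.insert_Icc_add_one_left_eq_Icc (by omega : l ≤ l + d + 1),
      prod_insert (by simp)]
  rw [g, g, h1, h2, h3, Nat.factorial_succ, pow_succ, mul_div_assoc', mul_div_mul_left _ _ h]
  push_cast
  ring

theorem g_self (a m : ℝ) {n : ℕ} (h : a * n + m ≠ 0) : (a * n + m) * g a m n n = 1 := by
  simp [g, h]

/-- The Pascal-type relation for `g`. -/
theorem g_add_g (a m : ℝ) {n l : ℕ} (hl : l ≤ n)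
    (h : ∀ k : ℕ, l ≤ k → k ≤ n + 1 → a * k + m ≠ 0) :
    g a m (n + 1) l + g a m (n + 1) (l + 1) = g a m n l := by
  have hl0 := h l le_rfl (by omega)
  have hn := h (n + 1) (by omega) le_rfl
  have h2 : g a m (n + 1) (l + 1) * (a * (n + 1 : ℕ) + m) = (a * l + m) * g a m n l := by
    have h3 : ∏ k ∈ Icc (l + 1) (n + 1), (a * (k : ℝ) + m)
        = (∏ k ∈ Icc (l + 1) n, (a * (k : ℝ) + m)) * (a * (n + 1 : ℕ) + m) :=
      Finset.prod_Icc_succ_top (by omega) _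
    have h4 : ∏ k ∈ Icc l n, (a * (k : ℝ) + m)
        = (a * l + m) * ∏ k ∈ Icc (l + 1) n, (a * (k : ℝ) + m) := by
      rw [← Finset.insert_Icc_add_one_left_eq_Icc hl, prod_insert (by simp)]
    rw [g, g, h3, h4, Nat.add_sub_add_right, mul_div_assoc', mul_div_mul_left _ _ hl0,
      div_mul_eq_mul_div, mul_div_mul_right _ _ hn]
  have h5 := g_mul_eq a m (show l < n + 1 by omega) hl0
  have h6 : ((n + 1 - l : ℕ) : ℝ) = (n : ℝ) + 1 - l := by
    rw [Nat.cast_sub (by omega)]; push_cast; ring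
  rw [h6] at h5
  push_cast at h2
  apply mul_left_cancel₀ hl0
  linear_combination h5 + h2

theorem sum_powerset_g {α : Type*} [DecidableEq α] (a m : ℝ) (l : ℕ) (D : Finset α) :
    ∀ N : ℕ, l + D.card ≤ N → (∀ k : ℕ, l ≤ k → k ≤ N → a * k + m ≠ 0) →
      ∑ Y ∈ D.powerset, g a m N (l + Y.card) = g a m (N - D.card) l := by
  induction D using Finset.induction_on with
  | empty => intro N _ _; simp
  | insert x D hx ih =>
    intro N hN h
    rw [card_insert_of_notMem hx] at hN ⊢
    obtain ⟨M, rfl⟩ : ∃ M, N = M + 1 := ⟨N - 1, by omega⟩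
    rw [sum_powerset_insert hx, ← sum_add_distrib, Nat.add_sub_add_right,
      ← ih M (by omega) fun k h1 h2 => h k h1 (by omega)]
    refine sum_congr rfl fun Y hY => ?_
    have hYD := mem_powerset.1 hY
    have hc := card_le_card hYD
    rw [card_insert_of_notMem fun hxY => hx (hYD hxY), ← add_assoc]
    exact g_add_g a m (by omega) fun k h1 h2 => h k (by omega) h2

theorem sum_Icc_g {α : Type*} [DecidableEq α] (a m : ℝ) {N : ℕ} {S T : Finset α} (hST : S ⊆ T)
    (hT : T.card ≤ N) (h : ∀ k : ℕ, S.card ≤ k → k ≤ N → a * k + m ≠ 0) :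
    ∑ X ∈ Icc S T, g a m N X.card = g a m (N - T.card + S.card) S.card := by
  have hc := card_sdiff_add_card_eq_card hST
  rw [Finset.Icc_eq_image_powerset hST, sum_image]
  · have := sum_powerset_g a m S.card (T \ S) N (by omega) h
    rw [show N - T.card + S.card = N - (T \ S).card by omega, ← this]
    refine sum_congr rfl fun Y hY => ?_
    rw [card_union_of_disjoint]
    exact disjoint_sdiff.mono_right (mem_powerset.1 hY)
  · intro Y hY Y' hY' hYY
    have h1 : Disjoint S Y := disjoint_sdiff.mono_right (mem_powerset.1 hY)
    have h2 : Disjoint S Y' := disjoint_sdiff.mono_right (mem_powerset.1 hY')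
    simpa [union_sdiff_cancel_left h1, union_sdiff_cancel_left h2] using congrArg (· \ S) hYY

theorem mem_upSet {n : ℕ} {F : Finset (Finset (Fin n))} {X : Finset (Fin n)} :
    X ∈ upSet n F ↔ ∃ A ∈ F, A ⊆ X := by
  simp [upSet]

theorem zSet_eq_filter {n : ℕ} {F : Finset (Finset (Fin n))} {X : Finset (Fin n)}
    (hX : X ∈ upSet n F) : zSet n F X = X.filter fun x => X.erase x ∉ upSet n F := by
  have mem_z (x : Fin n) : x ∈ zSet n F X ↔ ∀ A ∈ F, A ⊆ X → x ∈ A := by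
    rw [zSet, if_pos hX, ← singleton_subset_iff, Finset.le_inf_iff]
    simp
  obtain ⟨A, hA, hAX⟩ := mem_upSet.1 hX
  ext x
  rw [mem_z, mem_filter]
  constructor
  · refine fun h => ⟨hAX (h A hA hAX), fun hu => ?_⟩
    obtain ⟨C, hC, hCX⟩ := mem_upSet.1 hu
    exact notMem_erase x X (hCX (h C hC (hCX.trans (erase_subset _ _))))
  · rintro ⟨-, h⟩ C hC hCX
    by_contra hx
    exact h (mem_upSet.2 ⟨C, hC, subset_erase.2 ⟨hCX, hx⟩⟩)

/-- Double counting of the covering pairs inside an upset. -/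
theorem sum_card_filter_erase_mem_upSet {n : ℕ} (F : Finset (Finset (Fin n))) (w : ℕ → ℝ) :
    ∑ X ∈ upSet n F, ((X.filter fun x => X.erase x ∈ upSet n F).card : ℝ) * w X.card
      = ∑ Y ∈ upSet n F, ((n - Y.card : ℕ) : ℝ) * w (Y.card + 1) := by
  have hL (X : Finset (Fin n)) :
      ((X.filter fun x => X.erase x ∈ upSet n F).card : ℝ) * w X.card
        = ∑ _x ∈ X.filter fun x => X.erase x ∈ upSet n F, w X.card := by
    rw [sum_const, nsmul_eq_mul]
  have hR (Y : Finset (Fin n)) :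
      ((n - Y.card : ℕ) : ℝ) * w (Y.card + 1) = ∑ _x ∈ Yᶜ, w (Y.card + 1) := by
    rw [sum_const, nsmul_eq_mul, card_compl, Fintype.card_fin]
  simp_rw [hL, hR, sum_sigma']
  refine sum_bij' (fun p _ => ⟨p.1.erase p.2, p.2⟩) (fun p _ => ⟨insert p.2 p.1, p.2⟩) ?_ ?_ ?_ ?_ ?_
  · rintro ⟨X, x⟩ h
    simp only [mem_sigma, mem_filter] at h
    simp [h.2.2]
  · rintro ⟨Y, x⟩ h
    simp only [mem_sigma, mem_compl] at h
    obtain ⟨C, hC, hCY⟩ := mem_upSet.1 h.1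
    simp only [mem_sigma, mem_filter, mem_insert_self, erase_insert h.2, h.1, and_true]
    exact mem_upSet.2 ⟨C, hC, hCY.trans (subset_insert _ _)⟩
  · rintro ⟨X, x⟩ h
    simp only [mem_sigma, mem_filter] at h
    simp [insert_erase h.2.1]
  · rintro ⟨Y, x⟩ h
    simp only [mem_sigma, mem_compl] at h
    simp [erase_insert h.2]
  · rintro ⟨X, x⟩ h
    simp only [mem_sigma, mem_filter] at h
    simp [card_erase_add_one h.2.1]

/-- The weighted Ahlswede–Zhang identity. -/
theorem sum_upSet_zSet (a m : ℝ) (n : ℕ) {F : Finset (Finset (Fin n))} (hF : F.Nonempty)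
    (h : ∀ X ∈ upSet n F, a * X.card + m ≠ 0) :
    ∑ X ∈ upSet n F, (a * (zSet n F X).card + m) * g a m n X.card = 1 := by
  have huniv : univ ∈ upSet n F := mem_upSet.2 (hF.imp fun C hC => ⟨hC, subset_univ _⟩)
  have hterm : ∀ X ∈ upSet n F, (a * (zSet n F X).card + m) * g a m n X.card
      = (a * X.card + m) * g a m n X.card
        - a * (((X.filter fun x => X.erase x ∈ upSet n F).card : ℝ) * g a m n X.card) := by
    intro X hX
    have := card_filter_add_card_filter_not (s := X) fun x => X.erase x ∈ upSet n F
    rw [zSet_eq_filter hX]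
    rw [← this]
    push_cast
    ring
  rw [sum_congr rfl hterm, sum_sub_distrib, ← mul_sum,
    sum_card_filter_erase_mem_upSet F (g a m n), mul_sum, ← sum_sub_distrib,
    sum_eq_single_of_mem univ huniv]
  · have := h univ huniv
    rw [card_univ, Fintype.card_fin] at this ⊢
    simp [g_self a m this]
  · intro X hX hne
    have hlt : X.card < n := by
      simpa using card_lt_univ_of_notMem (by simpa [eq_univ_iff_forall] using hne :
        ∃ x, x ∉ X).choose_spec
    rw [g_mul_eq a m hlt (h X hX)]
    ring

/-- Main theorem 2: the generalized Ahlswede–Cai identity with weights a, m. -/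
theorem generalized_ahlswede_cai_identity (a m : ℝ) (n q : ℕ) (hq : 0 < q)
    (A B : Fin q → Finset (Fin n))
    (hA : ∀ i, A i ≠ ∅)
    (hAB : ∀ j k, A j ⊆ B k ↔ j = k)
    (hk : ∀ k : ℕ,
      Finset.univ.inf' ⟨⟨0, hq⟩, Finset.mem_univ _⟩ (fun i => (A i).card) ≤ k →
      k ≤ n → a * k + m ≠ 0) :
    ∑ i, (a * (A i).card + m) * g a m (n - (B i).card + (A i).card) (A i).card
      + ∑ X ∈ upSet n (Finset.univ.image A) \ downSet n (Finset.univ.image B),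
          (a * (zSet n (Finset.univ.image A) X).card + m) * g a m n X.card
      = 1 := by
  have hF : (univ.image A).Nonempty := ⟨_, mem_image_of_mem A (mem_univ ⟨0, hq⟩)⟩
  have hk' (i : Fin q) (k : ℕ) (h1 : (A i).card ≤ k) (h2 : k ≤ n) : a * k + m ≠ 0 :=
    hk k ((inf'_le _ (mem_univ i)).trans h1) h2
  have hcard (X : Finset (Fin n)) : X.card ≤ n := by simpa using card_le_univ X
  have hinter : upSet n (univ.image A) ∩ downSet n (univ.image B)
      = univ.biUnion fun i => Icc (A i) (B i) := by
    ext X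
    simp only [upSet, downSet, mem_inter, mem_filter, mem_univ, true_and, mem_image,
      exists_exists_eq_and, mem_biUnion, mem_Icc]
    constructor
    · rintro ⟨⟨j, hj⟩, k, hk⟩
      obtain rfl := (hAB j k).1 (hj.trans hk)
      exact ⟨j, hj, hk⟩
    · rintro ⟨i, h1, h2⟩
      exact ⟨⟨i, h1⟩, i, h2⟩
  have hz (i : Fin q) (X : Finset (Fin n)) (hX : X ∈ Icc (A i) (B i)) :
      zSet n (univ.image A) X = A i := by
    obtain ⟨h1, h2⟩ := mem_Icc.1 hX
    have hfilter : (univ.image A).filter (fun C => C ⊆ X) = {A i} := by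
      ext C
      simp only [mem_filter, mem_image, mem_univ, true_and, mem_singleton]
      constructor
      · rintro ⟨⟨j, rfl⟩, hj⟩
        rw [(hAB j i).1 (hj.trans h2)]
      · rintro rfl
        exact ⟨⟨i, rfl⟩, h1⟩
    rw [zSet, if_pos (mem_upSet.2 ⟨A i, mem_image_of_mem A (mem_univ i), h1⟩), hfilter,
      inf_singleton, id]
  have hsum : ∑ i, (a * (A i).card + m) * g a m (n - (B i).card + (A i).card) (A i).card
      = ∑ X ∈ upSet n (univ.image A) ∩ downSet n (univ.image B),
          (a * (zSet n (univ.image A) X).card + m) * g a m n X.card := by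
    rw [hinter, sum_biUnion]
    · refine sum_congr rfl fun i _ => ?_
      rw [← sum_Icc_g a m ((hAB i i).2 rfl) (hcard _) (hk' i), mul_sum]
      exact sum_congr rfl fun X hX => by rw [hz i X hX]
    · intro i _ j _ hij
      refine disjoint_left.2 fun X hXi hXj => hij ?_
      exact (hAB i j).1 ((mem_Icc.1 hXi).1.trans (mem_Icc.1 hXj).2)
  rw [hsum, sum_inter_add_sum_sdiff]
  refine sum_upSet_zSet a m n hF fun X hX => ?_
  obtain ⟨C, hC, hCX⟩ := mem_upSet.1 hX
  obtain ⟨i, -, rfl⟩ := mem_image.1 hC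
  exact hk' i _ (card_le_card hCX) (hcard X)
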